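/- arXiv:2302.13649 — 2 statements merged into one kernel-verified Lean document; each statement's English description precedes it below -/
import Mathlib

section
/- Let G = { M(a,b) : a, b ∈ ℂ } ≤ GL(3,ℂ), where M(a,b) is the matrix with rows (e^a, 0, b), (0, 1, a), (0, 0, 1). Then the center of the group G is exactly the set { M(2πik, 0) : k ∈ ℤ }, i.e. the set of matrices with rows (1, 0, 0), (0, 1, 2πik), (0, 0, 1) for k ∈ ℤ. In particular, the center of G is an infinite discrete subgroup. -/
open Matrix

/-- The matrix `M(a,b)` with rows `(e^a, 0, b)`, `(0, 1, a)`, `(0, 0, 1)`. -/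
noncomputable def Mmat (a b : ℂ) : Matrix (Fin 3) (Fin 3) ℂ :=
  !![Complex.exp a, 0, b; 0, 1, a; 0, 0, 1]

theorem Mmat_mul (a b c d : ℂ) :
    Mmat a b * Mmat c d = Mmat (a + c) (b + Complex.exp a * d) := by
  ext i j
  fin_cases i <;> fin_cases j <;>
    simp [Mmat, Matrix.mul_apply, Fin.sum_univ_three, Complex.exp_add] <;> ring

theorem Mmat_inj {a b c d : ℂ} (h : Mmat a b = Mmat c d) : a = c ∧ b = d := by
  have h1 := congrFun (congrFun h 1) 2
  have h2 := congrFun (congrFun h 0) 2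
  simp [Mmat] at h1 h2
  exact ⟨h1, h2⟩

theorem Mmat_zero : Mmat 0 0 = 1 := by
  ext i j
  fin_cases i <;> fin_cases j <;> simp [Mmat]

/-- `M(a,b)` as an invertible matrix. -/
noncomputable def Munit (a b : ℂ) : GL (Fin 3) ℂ where
  val := Mmat a b
  inv := Mmat (-a) (-(Complex.exp (-a) * b))
  val_inv := by
    rw [Mmat_mul, ← Mmat_zero]
    congr 1
    · ring
    · have : Complex.exp a * Complex.exp (-a) = 1 := by rw [← Complex.exp_add]; simp
      linear_combination (-b) * this
  inv_val := by
    rw [Mmat_mul, ← Mmat_zero]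
    congr 1 <;> ring

theorem two_pi_inj {j k : ℤ}
    (h : ‖(2 * Real.pi * Complex.I * j : ℂ) - 2 * Real.pi * Complex.I * k‖ < 1) : j = k := by
  by_contra hne
  have e : (2 * Real.pi * Complex.I * j : ℂ) - 2 * Real.pi * Complex.I * k
      = ((2 * Real.pi * ((j - k : ℤ) : ℝ) : ℝ) : ℂ) * Complex.I := by push_cast; ring
  rw [e, norm_mul, Complex.norm_I, mul_one, Complex.norm_real, Real.norm_eq_abs, abs_mul,
    abs_of_pos Real.two_pi_pos] at h
  have h1 : (1 : ℝ) ≤ |((j - k : ℤ) : ℝ)| := by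
    have : (1 : ℤ) ≤ |j - k| := Int.one_le_abs (sub_ne_zero.mpr hne)
    exact_mod_cast this
  nlinarith [Real.pi_gt_three]

/-- for the subgroup `G = { M(a,b) : a, b ∈ ℂ }` of `GL(3,ℂ)`,
the center of `G` is exactly `{ M(2πik, 0) : k ∈ ℤ }`; in particular the
center is infinite and discrete. -/
theorem stmt_2
    (G : Subgroup (GL (Fin 3) ℂ))
    (hG : ∀ x : GL (Fin 3) ℂ,
      x ∈ G ↔ ∃ a b : ℂ, (x : Matrix (Fin 3) (Fin 3) ℂ) = Mmat a b) :
    (∀ x : G, x ∈ Subgroup.center G ↔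
      ∃ k : ℤ, ((x : GL (Fin 3) ℂ) : Matrix (Fin 3) (Fin 3) ℂ)
        = Mmat (2 * Real.pi * Complex.I * k) 0) ∧
    Infinite (Subgroup.center G) ∧
    DiscreteTopology
      ({A : Matrix (Fin 3) (Fin 3) ℂ |
        ∃ k : ℤ, A = Mmat (2 * Real.pi * Complex.I * k) 0} : Set _) := by
  have hc : ∀ x : G, x ∈ Subgroup.center G ↔
      ∃ k : ℤ, ((x : GL (Fin 3) ℂ) : Matrix (Fin 3) (Fin 3) ℂ)
        = Mmat (2 * Real.pi * Complex.I * k) 0 := by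
    intro x
    obtain ⟨a, b, hx⟩ := (hG x).1 x.2
    rw [Subgroup.mem_center_iff]
    constructor
    · intro h
      have key : ∀ c d : ℂ, Mmat c d * Mmat a b = Mmat a b * Mmat c d := by
        intro c d
        have := h ⟨Munit c d, (hG _).2 ⟨c, d, rfl⟩⟩
        have h2 := congrArg (fun y : G => ((y : GL (Fin 3) ℂ) : Matrix (Fin 3) (Fin 3) ℂ)) this
        simpa [hx, Munit] using h2
      have k1 := key 0 1
      have k2 := key (Real.log 2 : ℝ) 0
      rw [Mmat_mul, Mmat_mul] at k1 k2
      have e1 := (Mmat_inj k1).2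
      have e2 := (Mmat_inj k2).2
      rw [← Complex.ofReal_exp, Real.exp_log (by norm_num)] at e2
      rw [Complex.exp_zero] at e1
      have hb : b = 0 := by
        push_cast at e2
        linear_combination e2
      have ha : Complex.exp a = 1 := by linear_combination -e1
      obtain ⟨k, hk⟩ := Complex.exp_eq_one_iff.1 ha
      refine ⟨k, ?_⟩
      rw [hx, hb, hk]
      congr 1
      ring
    · rintro ⟨k, hk⟩ g
      obtain ⟨c, d, hg⟩ := (hG g).1 g.2
      apply Subtype.ext
      apply Units.ext
      have he : Complex.exp (2 * Real.pi * Complex.I * k) = 1 :=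
        Complex.exp_eq_one_iff.2 ⟨k, by ring⟩
      simp only [Subgroup.coe_mul, Units.val_mul]
      rw [hk, hg, Mmat_mul, Mmat_mul, he]
      congr 1 <;> ring
  refine ⟨hc, ?_, ?_⟩
  · refine Infinite.of_injective (fun k : ℤ =>
      (⟨⟨Munit (2 * Real.pi * Complex.I * k) 0, (hG _).2 ⟨_, _, rfl⟩⟩,
        (hc _).2 ⟨k, rfl⟩⟩ : Subgroup.center G)) ?_
    intro j k h
    have h2 := congrArg (fun y : Subgroup.center G =>
      (((y : G) : GL (Fin 3) ℂ) : Matrix (Fin 3) (Fin 3) ℂ)) h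
    have h3 := (Mmat_inj (show Mmat _ _ = Mmat _ _ from h2)).1
    exact two_pi_inj (by rw [h3]; simp)
  · rw [discreteTopology_subtype_iff']
    rintro _ ⟨k, rfl⟩
    refine ⟨(fun A : Matrix (Fin 3) (Fin 3) ℂ => A 1 2) ⁻¹'
      Metric.ball (2 * Real.pi * Complex.I * k) 1, ?_, ?_⟩
    · exact Metric.isOpen_ball.preimage (by fun_prop)
    · ext A
      constructor
      · rintro ⟨h, j, rfl⟩
        have : j = k := two_pi_inj (by simpa [Mmat, dist_eq_norm] using h)
        rw [this]; rfl
      · rintro rfl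
        exact ⟨by simp [Mmat], k, rfl⟩
end

section
/- Let G = { M(a,b) : a, b ∈ ℂ } ≤ GL(3,ℂ), where M(a,b) is the matrix with rows (e^a, 0, b), (0, 1, a), (0, 0, 1). Define φ(M(a,b)) to be the 2×2 complex matrix with rows (1, 0), (−b, e^a). Then φ is a group homomorphism from G to GL(2,ℂ), and its kernel is exactly the center of G, namely { M(2πik, 0) : k ∈ ℤ }. -/
open Matrix

theorem Mmat_det (a b : ℂ) : (Mmat a b).det ≠ 0 := by
  simp [Mmat, Matrix.det_fin_three]

/-- for the subgroup `G = { M(a,b) : a, b ∈ ℂ }` of `GL(3,ℂ)`,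
the assignment `M(a,b) ↦ !![1, 0; −b, e^a]` is a group homomorphism
`φ : G → GL(2,ℂ)` whose kernel is exactly the center of `G`, namely
`{ M(2πik, 0) : k ∈ ℤ }`. -/
theorem stmt_4
    (G : Subgroup (GL (Fin 3) ℂ))
    (hG : ∀ x : GL (Fin 3) ℂ,
      x ∈ G ↔ ∃ a b : ℂ, (x : Matrix (Fin 3) (Fin 3) ℂ) = Mmat a b) :
    ∃ φ : G →* GL (Fin 2) ℂ,
      (∀ x : G, ∀ a b : ℂ,
        ((x : GL (Fin 3) ℂ) : Matrix (Fin 3) (Fin 3) ℂ) = Mmat a b →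
          ((φ x : GL (Fin 2) ℂ) : Matrix (Fin 2) (Fin 2) ℂ)
            = !![1, 0; -b, Complex.exp a]) ∧
      φ.ker = Subgroup.center G ∧
      (∀ x : G, x ∈ φ.ker ↔
        ∃ k : ℤ, ((x : GL (Fin 3) ℂ) : Matrix (Fin 3) (Fin 3) ℂ)
          = Mmat (2 * Real.pi * Complex.I * k) 0) := by
  have key : ∀ x : G, ∃ a b : ℂ, ((x : GL (Fin 3) ℂ) : Matrix (Fin 3) (Fin 3) ℂ) = Mmat a b :=
    fun x => (hG x).1 x.2
  let F : Matrix (Fin 3) (Fin 3) ℂ → Matrix (Fin 2) (Fin 2) ℂ := fun m => !![1, 0; -(m 0 2), m 0 0]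
  have hF : ∀ a b, F (Mmat a b) = !![1, 0; -b, Complex.exp a] := by
    intro a b; simp [F, Mmat]
  let f : G →* Matrix (Fin 2) (Fin 2) ℂ :=
    { toFun := fun x => F ((x : GL (Fin 3) ℂ) : Matrix (Fin 3) (Fin 3) ℂ)
      map_one' := by
        ext i j
        fin_cases i <;> fin_cases j <;> simp [F]
      map_mul' := by
        intro x y
        obtain ⟨a, b, h⟩ := key x
        obtain ⟨c, d, h'⟩ := key y
        simp only [Subgroup.coe_mul, Units.val_mul, h, h', Mmat_mul, hF]
        ext i j
        fin_cases i <;> fin_cases j <;>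
          simp [Matrix.mul_apply, Fin.sum_univ_two, Complex.exp_add] <;> ring }
  have hφ : ∀ x : G, ∀ a b : ℂ,
        ((x : GL (Fin 3) ℂ) : Matrix (Fin 3) (Fin 3) ℂ) = Mmat a b →
          ((f.toHomUnits x : GL (Fin 2) ℂ) : Matrix (Fin 2) (Fin 2) ℂ)
            = !![1, 0; -b, Complex.exp a] := by
    intro x a b h
    rw [MonoidHom.coe_toHomUnits, ← hF, ← h]
    rfl
  have hker : ∀ x : G, ∀ a b : ℂ,
        ((x : GL (Fin 3) ℂ) : Matrix (Fin 3) (Fin 3) ℂ) = Mmat a b →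
          (x ∈ f.toHomUnits.ker ↔ Complex.exp a = 1 ∧ b = 0) := by
    intro x a b h
    rw [MonoidHom.mem_ker, Units.ext_iff, hφ x a b h]
    constructor
    · intro e
      have h1 := congrFun (congrFun e 1) 0
      have h2 := congrFun (congrFun e 1) 1
      simp at h1 h2
      exact ⟨h2, h1⟩
    · rintro ⟨h1, h2⟩
      rw [h1, h2]
      ext i j
      fin_cases i <;> fin_cases j <;> simp
  have hex : ∀ a b : ℂ, ∃ x : G,
      ((x : GL (Fin 3) ℂ) : Matrix (Fin 3) (Fin 3) ℂ) = Mmat a b := fun a b =>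
    ⟨⟨Matrix.GeneralLinearGroup.mkOfDetNeZero _ (Mmat_det a b), (hG _).2 ⟨a, b, rfl⟩⟩, rfl⟩
  refine ⟨f.toHomUnits, hφ, ?_, ?_⟩
  · ext x
    obtain ⟨a, b, h⟩ := key x
    rw [hker x a b h, Subgroup.mem_center_iff]
    constructor
    · rintro ⟨h1, h2⟩ y
      obtain ⟨c, d, h'⟩ := key y
      apply Subtype.ext
      apply Units.ext
      simp only [Subgroup.coe_mul, Units.val_mul, h, h', Mmat_mul, h1, h2]
      congr 1 <;> ring
    · intro hc
      have comm : ∀ c d : ℂ, d + Complex.exp c * b = b + Complex.exp a * d := by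
        intro c d
        obtain ⟨y, h'⟩ := hex c d
        have e := congrArg (fun z : G => ((z : GL (Fin 3) ℂ) : Matrix (Fin 3) (Fin 3) ℂ)) (hc y)
        simp only [Subgroup.coe_mul, Units.val_mul, h, h', Mmat_mul] at e
        exact (Mmat_inj e).2
      have e1 := comm 0 1
      have e2 := comm (Real.pi * Complex.I) 0
      rw [Complex.exp_pi_mul_I] at e2
      rw [Complex.exp_zero] at e1
      constructor
      · linear_combination -e1
      · linear_combination (-1/2) * e2
  · intro x
    obtain ⟨a, b, h⟩ := key x
    rw [hker x a b h, h, Complex.exp_eq_one_iff]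
    constructor
    · rintro ⟨⟨k, hk⟩, hb⟩
      exact ⟨k, by rw [hk, hb, mul_comm]⟩
    · rintro ⟨k, hk⟩
      obtain ⟨h1, h2⟩ := Mmat_inj hk
      exact ⟨⟨k, by rw [h1, mul_comm]⟩, h2⟩
end
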